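/- arXiv:2011.02361 — 3 statements merged into one kernel-verified Lean document; each statement's English description precedes it below -/
import Mathlib

section
/- In the group algebra ℂ[S_n] the identity Σ_{σ ∈ S_n} sgn(σ) σ = ∏_{j=2}^{n} ∏_{i=1}^{j−1} (1 − σ_{ij}/(j−i)) holds, where the factors on the right are multiplied from left to right in order of increasing j, and for each fixed j in order of increasing i. -/
open scoped BigOperators

/-- Transposition of `i` and `j` in `S_n`, given natural number (0-based) indices. -/
def swapFin (n : ℕ) (i j : ℕ) : Equiv.Perm (Fin n) :=
  if h : i < n ∧ j < n then Equiv.swap ⟨i, h.1⟩ ⟨j, h.2⟩ else 1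

/-- The list of pairs `(i, j)` with `0 ≤ i < j < n`, ordered with `j` increasing from left
to right and, for each fixed `j`, with `i` increasing. -/
def pairList (n : ℕ) : List (ℕ × ℕ) :=
  (List.range n).flatMap fun j => (List.range j).map fun i => (i, j)

/-- The permutations of `Fin n` that fix every index `≥ m`, that is, the copy of `S_m` in `S_n`. -/
def fixingFrom (n m : ℕ) : Finset (Equiv.Perm (Fin n)) :=
  Finset.univ.filter fun σ => ∀ x : Fin n, m ≤ x.1 → σ x = x

theorem mem_fixingFrom {n m : ℕ} {σ : Equiv.Perm (Fin n)} :
    σ ∈ fixingFrom n m ↔ ∀ x : Fin n, m ≤ x.1 → σ x = x := by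
  simp [fixingFrom]

/-- The antisymmetrizer of the copy of `S_m` in `S_n`. -/
noncomputable def partialAntisymmetrizer (n m : ℕ) : MonoidAlgebra ℂ (Equiv.Perm (Fin n)) :=
  ∑ σ ∈ fixingFrom n m, MonoidAlgebra.single σ (((Equiv.Perm.sign σ : ℤ) : ℂ))

theorem swapFin_of_lt {n i j : ℕ} (hi : i < n) (hj : j < n) :
    swapFin n i j = Equiv.swap ⟨i, hi⟩ ⟨j, hj⟩ := by
  simp [swapFin, hi, hj]

theorem swapFin_mul_self (n i j : ℕ) : swapFin n i j * swapFin n i j = 1 := by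
  unfold swapFin
  split_ifs <;> simp

theorem sign_swapFin {n i j : ℕ} (hij : i < j) (hj : j < n) :
    Equiv.Perm.sign (swapFin n i j) = -1 := by
  rw [swapFin_of_lt (hij.trans hj) hj]
  exact Equiv.Perm.sign_swap (by simp [hij.ne])

theorem swapFin_mem_fixingFrom {n m i j : ℕ} (hi : i < m) (hj : j < m) :
    swapFin n i j ∈ fixingFrom n m := by
  rw [mem_fixingFrom]
  intro x hx
  unfold swapFin
  split_ifs
  · apply Equiv.swap_apply_of_ne_of_ne <;> simp [Fin.ext_iff] <;> omega
  · rfl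

theorem mul_mem_fixingFrom {n m : ℕ} {σ τ : Equiv.Perm (Fin n)}
    (hσ : σ ∈ fixingFrom n m) (hτ : τ ∈ fixingFrom n m) : σ * τ ∈ fixingFrom n m := by
  rw [mem_fixingFrom] at *
  intro x hx
  rw [Equiv.Perm.mul_apply, hτ x hx, hσ x hx]

theorem fixingFrom_mono {n m k : ℕ} (h : m ≤ k) : fixingFrom n m ⊆ fixingFrom n k := by
  intro σ hσ
  rw [mem_fixingFrom] at *
  exact fun x hx => hσ x (h.trans hx)

theorem partialAntisymmetrizer_mul_swapFin {n m i j : ℕ} (hij : i < j) (hjm : j < m)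
    (hj : j < n) :
    partialAntisymmetrizer n m * MonoidAlgebra.single (swapFin n i j) (1 : ℂ) =
      -partialAntisymmetrizer n m := by
  have hmem : swapFin n i j ∈ fixingFrom n m := swapFin_mem_fixingFrom (hij.trans hjm) hjm
  simp only [partialAntisymmetrizer, Finset.sum_mul, MonoidAlgebra.single_mul_single, mul_one,
    ← Finset.sum_neg_distrib]
  refine Finset.sum_bij' (fun σ _ => σ * swapFin n i j) (fun σ _ => σ * swapFin n i j)
    (fun σ hσ => mul_mem_fixingFrom hσ hmem) (fun σ hσ => mul_mem_fixingFrom hσ hmem)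
    ?_ ?_ ?_
  · simp [mul_assoc, swapFin_mul_self]
  · simp [mul_assoc, swapFin_mul_self]
  · simp [sign_swapFin hij hj]

theorem swapFin_mul_swapFin {n i k m : ℕ} (hik : i < k) (hkm : k < m) (hm : m < n) :
    swapFin n i m * swapFin n k m = swapFin n i k * swapFin n i m := by
  rw [swapFin_of_lt (by omega) hm, swapFin_of_lt (by omega) hm,
    swapFin_of_lt (by omega) (by omega)]
  ext x
  simp only [Equiv.Perm.mul_apply, Equiv.swap_apply_def, Fin.ext_iff]
  split_ifs <;> simp_all <;> omega

theorem partialAntisymmetrizer_succ {n m : ℕ} (hm : m < n) :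
    partialAntisymmetrizer n (m + 1) = partialAntisymmetrizer n m *
      (1 - ∑ i ∈ Finset.range m, MonoidAlgebra.single (swapFin n i m) (1 : ℂ)) := by
  have hself : swapFin n m m = 1 := by
    rw [swapFin_of_lt hm hm, Equiv.swap_self, Equiv.Perm.one_def]
  have key : partialAntisymmetrizer n (m + 1) =
      ∑ p ∈ fixingFrom n m ×ˢ Finset.range (m + 1), MonoidAlgebra.single
        (p.1 * swapFin n p.2 m) (((Equiv.Perm.sign (p.1 * swapFin n p.2 m) : ℤ) : ℂ)) := by
    symm
    refine Finset.sum_bij' (fun p _ => p.1 * swapFin n p.2 m)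
      (fun σ _ => (σ * swapFin n (σ⁻¹ ⟨m, hm⟩).1 m, (σ⁻¹ ⟨m, hm⟩).1)) ?_ ?_ ?_ ?_ ?_
    · rintro ⟨τ, i⟩ hp
      simp only [Finset.mem_product, Finset.mem_range] at hp
      exact mul_mem_fixingFrom (fixingFrom_mono m.le_succ hp.1)
        (swapFin_mem_fixingFrom hp.2 m.lt_succ_self)
    · intro σ hσ
      have hlt : (σ⁻¹ ⟨m, hm⟩).1 < m + 1 := by
        by_contra! h
        have := mem_fixingFrom.1 hσ _ h
        rw [← Equiv.Perm.mul_apply, mul_inv_cancel, Equiv.Perm.one_apply] at this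
        rw [← this] at h
        simp at h
      have hmem := mul_mem_fixingFrom hσ (swapFin_mem_fixingFrom (n := n) hlt m.lt_succ_self)
      simp only [Finset.mem_product, Finset.mem_range]
      refine ⟨mem_fixingFrom.2 fun x hx => ?_, hlt⟩
      rcases hx.eq_or_lt with h | h
      · obtain rfl : x = ⟨m, hm⟩ := Fin.ext h.symm
        rw [Equiv.Perm.mul_apply, swapFin_of_lt (Fin.is_lt _) hm, Equiv.swap_apply_right]
        simp
      · exact mem_fixingFrom.1 hmem x h
    · rintro ⟨τ, i⟩ hp
      simp only [Finset.mem_product, Finset.mem_range] at hp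
      have hi : i < n := by omega
      have hτ : τ⁻¹ ⟨m, hm⟩ = ⟨m, hm⟩ := by
        rw [Equiv.Perm.inv_eq_iff_eq]
        exact (mem_fixingFrom.1 hp.1 _ le_rfl).symm
      have hinv : (τ * swapFin n i m)⁻¹ ⟨m, hm⟩ = ⟨i, hi⟩ := by
        rw [mul_inv_rev, Equiv.Perm.mul_apply, hτ, swapFin_of_lt hi hm, Equiv.swap_inv,
          Equiv.swap_apply_right]
      simp only [hinv, mul_assoc, swapFin_mul_self, mul_one]
    · intro σ _
      simp only [mul_assoc, swapFin_mul_self, mul_one]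
    · intro p _
      rfl
  rw [key, Finset.sum_product, partialAntisymmetrizer, Finset.sum_mul]
  refine Finset.sum_congr rfl fun σ _ => ?_
  rw [Finset.sum_range_succ, hself, mul_sub, mul_one, mul_one, Finset.mul_sum, sub_eq_neg_add,
    ← Finset.sum_neg_distrib]
  congr 1
  refine Finset.sum_congr rfl fun i hi => ?_
  simp [MonoidAlgebra.single_mul_single, sign_swapFin (Finset.mem_range.1 hi) hm]

theorem partialAntisymmetrizer_mul_prod {n m : ℕ} (hm : m < n) (k : ℕ) (hk : k ≤ m) :
    partialAntisymmetrizer n m * ((List.range k).map fun i : ℕ =>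
        (1 : MonoidAlgebra ℂ (Equiv.Perm (Fin n))) -
          ((m : ℂ) - (i : ℂ))⁻¹ • MonoidAlgebra.single (swapFin n i m) (1 : ℂ)).prod =
      partialAntisymmetrizer n m * (1 - ((m : ℂ) - k + 1)⁻¹ •
        ∑ i ∈ Finset.range k, MonoidAlgebra.single (swapFin n i m) (1 : ℂ)) := by
  induction k with
  | zero => simp
  | succ k ih =>
    have hcross : partialAntisymmetrizer n m *
        ((∑ i ∈ Finset.range k, MonoidAlgebra.single (swapFin n i m) (1 : ℂ)) *
          MonoidAlgebra.single (swapFin n k m) (1 : ℂ)) = -(partialAntisymmetrizer n m *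
            ∑ i ∈ Finset.range k, MonoidAlgebra.single (swapFin n i m) (1 : ℂ)) := by
      rw [Finset.sum_mul, Finset.mul_sum, Finset.mul_sum, ← Finset.sum_neg_distrib]
      refine Finset.sum_congr rfl fun i hi => ?_
      have hik := Finset.mem_range.1 hi
      rw [MonoidAlgebra.single_mul_single, swapFin_mul_swapFin hik hk hm,
        ← MonoidAlgebra.single_mul_single, ← mul_assoc,
        partialAntisymmetrizer_mul_swapFin hik hk (by omega), neg_mul]
    have hne : (m : ℂ) - k ≠ 0 := by
      rw [sub_ne_zero, Nat.cast_injective.ne_iff]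
      omega
    have hne' : (m : ℂ) - k + 1 ≠ 0 := by
      have : ((m - k + 1 : ℕ) : ℂ) ≠ 0 := Nat.cast_ne_zero.2 (Nat.succ_ne_zero _)
      rwa [Nat.cast_add, Nat.cast_sub (by omega), Nat.cast_one] at this
    have hcoeff : ((m : ℂ) - k + 1)⁻¹ + ((m : ℂ) - k)⁻¹ * ((m : ℂ) - k + 1)⁻¹ =
        ((m : ℂ) - k)⁻¹ := by
      field_simp
    rw [List.range_succ, List.map_append, List.prod_append, ← mul_assoc, ih (by omega),
      Finset.sum_range_succ, show (m : ℂ) - (k + 1 : ℕ) + 1 = m - k by push_cast; ring]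
    simp only [List.map_cons, List.map_nil, List.prod_cons, List.prod_nil, mul_one]
    generalize (∑ i ∈ Finset.range k, MonoidAlgebra.single (swapFin n i m) (1 : ℂ)) = X at *
    have hsmul := congrArg (· • (partialAntisymmetrizer n m * X)) hcoeff
    rw [← mul_assoc] at hcross
    simp only [sub_mul, mul_sub, mul_one, smul_mul_assoc, mul_smul_comm, hcross, smul_add,
      mul_add] at hsmul ⊢
    linear_combination (norm := module) (-1 : ℂ) • hsmul

theorem pairList_succ (m : ℕ) :
    pairList (m + 1) = pairList m ++ (List.range m).map fun i => (i, m) := by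
  simp [pairList, List.range_succ]

theorem prod_pairList_eq_partialAntisymmetrizer {n : ℕ} (m : ℕ) (hm : m ≤ n) :
    ((pairList m).map fun p =>
        (1 : MonoidAlgebra ℂ (Equiv.Perm (Fin n))) -
          ((p.2 : ℂ) - (p.1 : ℂ))⁻¹ • MonoidAlgebra.single (swapFin n p.1 p.2) (1 : ℂ)).prod =
      partialAntisymmetrizer n m := by
  induction m with
  | zero =>
    have h : fixingFrom n 0 = {1} := by
      ext σ
      simp [mem_fixingFrom, Equiv.ext_iff]
    simp [pairList, partialAntisymmetrizer, h, MonoidAlgebra.one_def]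
  | succ m ih =>
    have h := partialAntisymmetrizer_mul_prod (Nat.lt_of_succ_le hm) m le_rfl
    rw [sub_self, zero_add, inv_one, one_smul,
      ← partialAntisymmetrizer_succ (Nat.lt_of_succ_le hm)] at h
    rw [pairList_succ, List.map_append, List.prod_append, ih (by omega), List.map_map, ← h]
    rfl

/-- in the group algebra `ℂ[S_n]`,
`Σ_{σ ∈ S_n} sgn(σ) σ = ∏_{j} ∏_{i<j} (1 − σ_{ij}/(j−i))`, the factors on the right being
multiplied from left to right in order of increasing `j` and, for fixed `j`, increasing `i`. -/
theorem antisymmetrizer_factorization (n : ℕ) :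
    (∑ σ : Equiv.Perm (Fin n),
        MonoidAlgebra.single σ (((Equiv.Perm.sign σ : ℤ) : ℂ))) =
      ((pairList n).map fun p =>
        (1 : MonoidAlgebra ℂ (Equiv.Perm (Fin n))) -
          ((p.2 : ℂ) - (p.1 : ℂ))⁻¹ • MonoidAlgebra.single (swapFin n p.1 p.2) (1 : ℂ)).prod := by
  have h : fixingFrom n n = Finset.univ := by
    ext σ
    simp only [mem_fixingFrom, Finset.mem_univ, iff_true]
    intro x hx
    omega
  rw [prod_pairList_eq_partialAntisymmetrizer n le_rfl, partialAntisymmetrizer, h]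
end

section
/- In the group algebra ℂ[S_n] the identity Σ_{σ ∈ S_n} σ = ∏_{j=2}^{n} ∏_{i=1}^{j−1} (1 + σ_{ij}/(j−i)) holds, where the factors on the right are multiplied from left to right in order of increasing j, and for each fixed j in order of increasing i. -/
open scoped BigOperators

/-- The permutations of `Fin n` fixing every index `≥ m`, a copy of `S_m` inside `S_n`. -/
def permFixingGE (n m : ℕ) : Finset (Equiv.Perm (Fin n)) :=
  Finset.univ.filter fun σ => ∀ x : Fin n, m ≤ x → σ x = x

/-- The sum of the elements of `S_m` in the group algebra of `S_n`. -/
noncomputable def partialSymmetrizer (n m : ℕ) : MonoidAlgebra ℂ (Equiv.Perm (Fin n)) :=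
  ∑ σ ∈ permFixingGE n m, MonoidAlgebra.single σ (1 : ℂ)

theorem mem_permFixingGE {n m : ℕ} {σ : Equiv.Perm (Fin n)} :
    σ ∈ permFixingGE n m ↔ ∀ x : Fin n, m ≤ x → σ x = x := by
  simp [permFixingGE]

theorem mul_mem_permFixingGE {n m : ℕ} {σ τ : Equiv.Perm (Fin n)}
    (hσ : σ ∈ permFixingGE n m) (hτ : τ ∈ permFixingGE n m) : σ * τ ∈ permFixingGE n m := by
  rw [mem_permFixingGE] at *
  intro x hx
  rw [Equiv.Perm.mul_apply, hτ x hx, hσ x hx]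

theorem inv_mem_permFixingGE {n m : ℕ} {σ : Equiv.Perm (Fin n)}
    (hσ : σ ∈ permFixingGE n m) : σ⁻¹ ∈ permFixingGE n m := by
  rw [mem_permFixingGE] at *
  intro x hx
  rw [Equiv.Perm.inv_eq_iff_eq, hσ x hx]

theorem swapFin_mem_permFixingGE {n m i j : ℕ} (hi : i < m) (hj : j < m) (hm : m ≤ n) :
    swapFin n i j ∈ permFixingGE n m := by
  rw [mem_permFixingGE, swapFin_of_lt (hi.trans_le hm) (hj.trans_le hm)]
  intro x hx
  apply Equiv.swap_apply_of_ne_of_ne <;> (rintro rfl; simp at hx; omega)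

theorem partialSymmetrizer_mul_single {n m : ℕ} {τ : Equiv.Perm (Fin n)}
    (hτ : τ ∈ permFixingGE n m) :
    partialSymmetrizer n m * MonoidAlgebra.single τ 1 = partialSymmetrizer n m := by
  simp only [partialSymmetrizer, Finset.sum_mul, MonoidAlgebra.single_mul_single, mul_one]
  refine Finset.sum_nbij' (· * τ) (· * τ⁻¹) (fun σ hσ => mul_mem_permFixingGE hσ hτ)
    (fun σ hσ => mul_mem_permFixingGE hσ (inv_mem_permFixingGE hτ)) ?_ ?_ ?_ <;> simp

/-- Coset decomposition of `S_{m+1}` with respect to `S_m`. -/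
theorem partialSymmetrizer_mul_sum_swapFin {n m : ℕ} (hm : m < n) :
    partialSymmetrizer n m *
        ∑ i ∈ Finset.range (m + 1), MonoidAlgebra.single (swapFin n i m) (1 : ℂ) =
      partialSymmetrizer n (m + 1) := by
  simp only [partialSymmetrizer, Finset.sum_mul_sum, MonoidAlgebra.single_mul_single, mul_one]
  rw [← Finset.sum_product']
  refine Finset.sum_bij' (fun p _ => p.1 * swapFin n p.2 m)
    (fun σ _ => (σ * swapFin n (σ⁻¹ ⟨m, hm⟩ : Fin n) m, ((σ⁻¹ ⟨m, hm⟩ : Fin n) : ℕ)))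
    ?_ ?_ ?_ ?_ ?_
  · rintro ⟨τ, i⟩ h
    simp only [Finset.mem_product, Finset.mem_range] at h
    refine mul_mem_permFixingGE ?_ (swapFin_mem_permFixingGE h.2 (by omega) hm)
    rw [mem_permFixingGE]
    exact fun x hx => mem_permFixingGE.1 h.1 x (by omega)
  · intro σ h
    have hlt : ((σ⁻¹ ⟨m, hm⟩ : Fin n) : ℕ) < m + 1 := by
      by_contra! hx
      have := mem_permFixingGE.1 h _ hx
      rw [← Equiv.Perm.mul_apply, mul_inv_cancel, Equiv.Perm.one_apply] at this
      rw [← this] at hx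
      simp at hx
    simp only [Finset.mem_product, Finset.mem_range]
    refine ⟨?_, hlt⟩
    rw [mem_permFixingGE]
    intro x hx
    rcases hx.eq_or_lt with hx | hx
    · obtain rfl : x = ⟨m, hm⟩ := Fin.ext hx.symm
      simp [swapFin_of_lt (Fin.is_lt _) hm]
    · exact mem_permFixingGE.1
        (mul_mem_permFixingGE h (swapFin_mem_permFixingGE hlt (by omega) hm)) x hx
  · rintro ⟨τ, i⟩ h
    simp only [Finset.mem_product, Finset.mem_range] at h
    have hi : i < n := by omega
    have hτ : τ.symm ⟨m, hm⟩ = ⟨m, hm⟩ :=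
      mem_permFixingGE.1 (inv_mem_permFixingGE h.1) _ le_rfl
    simp [swapFin_of_lt hi hm, hτ, mul_assoc]
  · intro σ h
    simp [swapFin_of_lt (Fin.is_lt _) hm, mul_assoc]
  · intros
    rfl

theorem partialSymmetrizer_mul_prod_range {n m : ℕ} (hm : m < n) {k : ℕ} (hk : k ≤ m) :
    partialSymmetrizer n m * ((List.range k).map fun i : ℕ =>
        (1 : MonoidAlgebra ℂ (Equiv.Perm (Fin n))) +
          ((m : ℂ) - (i : ℂ))⁻¹ • MonoidAlgebra.single (swapFin n i m) (1 : ℂ)).prod =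
      partialSymmetrizer n m + ((m : ℂ) - k + 1)⁻¹ • ∑ i ∈ Finset.range k,
        partialSymmetrizer n m * MonoidAlgebra.single (swapFin n i m) (1 : ℂ) := by
  induction k with
  | zero => simp
  | succ k ih =>
    have hsum : (∑ i ∈ Finset.range k,
          partialSymmetrizer n m * MonoidAlgebra.single (swapFin n i m) (1 : ℂ)) *
            MonoidAlgebra.single (swapFin n k m) (1 : ℂ) =
        ∑ i ∈ Finset.range k,
          partialSymmetrizer n m * MonoidAlgebra.single (swapFin n i m) (1 : ℂ) := by
      rw [Finset.sum_mul]
      refine Finset.sum_congr rfl fun i hi => ?_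
      have hik := Finset.mem_range.1 hi
      rw [mul_assoc, MonoidAlgebra.single_mul_single, swapFin_mul_swapFin hik hk hm,
        ← MonoidAlgebra.single_mul_single, ← mul_assoc,
        partialSymmetrizer_mul_single (swapFin_mem_permFixingGE (by omega) hk hm.le)]
    have h₁ : (m : ℂ) - k ≠ 0 := sub_ne_zero.2 (by exact_mod_cast (by omega : m ≠ k))
    have h₂ : (m : ℂ) - k + 1 ≠ 0 := by
      have : ((m - k + 1 : ℕ) : ℂ) ≠ 0 := Nat.cast_ne_zero.2 (by omega)
      rwa [Nat.cast_add, Nat.cast_sub (by omega), Nat.cast_one] at this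
    have hc : ((m : ℂ) - k + 1)⁻¹ + ((m : ℂ) - k)⁻¹ * ((m : ℂ) - k + 1)⁻¹ =
        ((m : ℂ) - k)⁻¹ := by
      field_simp
    have hc' : (m : ℂ) - (k + 1 : ℕ) + 1 = m - k := by push_cast; ring
    rw [List.range_succ, List.map_append, List.prod_append, ← mul_assoc, ih (by omega),
      Finset.sum_range_succ, hc']
    simp only [List.map_cons, List.map_nil, List.prod_cons, List.prod_nil, mul_one, mul_add,
      add_mul, mul_smul_comm, smul_mul_assoc, hsum, smul_add, smul_smul]
    nth_rw 3 [← hc]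
    rw [add_smul]
    abel

theorem prod_pairList {n m : ℕ} (hm : m ≤ n) :
    ((pairList m).map fun p =>
        (1 : MonoidAlgebra ℂ (Equiv.Perm (Fin n))) +
          ((p.2 : ℂ) - (p.1 : ℂ))⁻¹ • MonoidAlgebra.single (swapFin n p.1 p.2) (1 : ℂ)).prod =
      partialSymmetrizer n m := by
  induction m with
  | zero =>
    have : permFixingGE n 0 = {1} := by
      ext σ
      simp [mem_permFixingGE, Equiv.ext_iff]
    simp [pairList, partialSymmetrizer, this, MonoidAlgebra.one_def]
  | succ m ih =>
    have hpl : pairList (m + 1) = pairList m ++ (List.range m).map fun i => (i, m) := by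
      simp [pairList, List.range_succ]
    have hself : swapFin n m m = 1 := by simp [swapFin_of_lt hm hm, Equiv.Perm.one_def]
    rw [hpl, List.map_append, List.prod_append, ih (by omega), List.map_map]
    refine (partialSymmetrizer_mul_prod_range hm le_rfl).trans ?_
    rw [← partialSymmetrizer_mul_sum_swapFin hm, Finset.sum_range_succ, hself,
      ← MonoidAlgebra.one_def, mul_add, mul_one, Finset.mul_sum]
    simp [add_comm]

/-- in the group algebra `ℂ[S_n]`,
`Σ_{σ ∈ S_n} σ = ∏_{j} ∏_{i<j} (1 + σ_{ij}/(j−i))`, the factors on the right being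
multiplied from left to right in order of increasing `j` and, for fixed `j`, increasing `i`. -/
theorem symmetrizer_factorization (n : ℕ) :
    (∑ σ : Equiv.Perm (Fin n), MonoidAlgebra.single σ (1 : ℂ)) =
      ((pairList n).map fun p =>
        (1 : MonoidAlgebra ℂ (Equiv.Perm (Fin n))) +
          ((p.2 : ℂ) - (p.1 : ℂ))⁻¹ • MonoidAlgebra.single (swapFin n p.1 p.2) (1 : ℂ)).prod := by
  rw [prod_pairList le_rfl, partialSymmetrizer]
  congr 1
  ext σ
  simp [mem_permFixingGE, fun x : Fin n => x.is_lt.not_ge]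
end

section
/- Let 𝔞 be a finite-dimensional complex Lie algebra whose centre is zero. Then the centre of the universal enveloping algebra U(𝔞[X]) of the polynomial current Lie algebra 𝔞[X] is trivial, i.e. equals ℂ·1. (This is the purely even case of the paper's proposition, whose proof applies verbatim.) -/
open scoped TensorProduct

/-- The polynomial current Lie algebra `𝔞[X] = ℂ[X] ⊗ 𝔞` is a Lie algebra over `ℂ`
(with the base-change bracket `[f ⊗ x, g ⊗ y] = fg ⊗ [x,y]`). -/
noncomputable instance currentLieAlgebra (𝔞 : Type*) [LieRing 𝔞] [LieAlgebra ℂ 𝔞] :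
    LieAlgebra ℂ (Polynomial ℂ ⊗[ℂ] 𝔞) where
  lie_smul c x y := by
    have h := lie_smul (R := Polynomial ℂ) ((algebraMap ℂ (Polynomial ℂ)) c) x y
    rw [algebraMap_smul, algebraMap_smul] at h
    exact h

namespace UniversalEnvelopingAlgebra

attribute [local instance] LieRing.ofAssociativeRing

variable {K L : Type*} [Field K] [LieRing L] [LieAlgebra K L]

local notation "𝓤" => UniversalEnvelopingAlgebra

/-- The comultiplication, determined by `x ↦ x ⊗ 1 + 1 ⊗ x` on `L`. -/
noncomputable def comulHom : 𝓤 K L →ₐ[K] 𝓤 K L ⊗[K] 𝓤 K L :=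
  lift K
    { toLinearMap := (TensorProduct.mk K (𝓤 K L) (𝓤 K L)).flip 1 ∘ₗ (ι K : L →ₗ⁅K⁆ 𝓤 K L) +
        TensorProduct.mk K (𝓤 K L) (𝓤 K L) 1 ∘ₗ (ι K : L →ₗ⁅K⁆ 𝓤 K L)
      map_lie' := fun {x y} => by
        simp only [AddHom.toFun_eq_coe, LinearMap.coe_toAddHom, LinearMap.add_apply,
          LinearMap.comp_apply, LinearMap.flip_apply, TensorProduct.mk_apply,
          LieHom.coe_toLinearMap, LieHom.map_lie, LieRing.of_associative_ring_bracket,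
          add_mul, mul_add, Algebra.TensorProduct.tmul_mul_tmul, mul_one, one_mul,
          TensorProduct.sub_tmul, TensorProduct.tmul_sub]
        abel }

lemma comulHom_ι (x : L) :
    comulHom (ι K x) = ι K x ⊗ₜ[K] (1 : 𝓤 K L) + (1 : 𝓤 K L) ⊗ₜ[K] ι K x :=
  lift_ι_apply K _ x

/-- The augmentation, which is zero on `L`. -/
noncomputable def counitHom : 𝓤 K L →ₐ[K] K := lift K 0

lemma counitHom_ι (x : L) : counitHom (ι K x) = 0 := by
  rw [counitHom, lift_ι_apply]; rfl

/-- The subspace `K ⊕ M` of the enveloping algebra attached to a subspace `M` of `L`. -/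
noncomputable def degreeLEOne (M : Submodule K L) : Submodule K (𝓤 K L) :=
  1 ⊔ M.map (ι K : L →ₗ⁅K⁆ 𝓤 K L).toLinearMap

/-- The span of the products of strictly fewer than `n` elements of the subspace `M`. -/
noncomputable def degreeLT (M : Submodule K L) : ℕ → Submodule K (𝓤 K L)
  | 0 => ⊥
  | n + 1 => degreeLEOne M ^ n

variable {M M' : Submodule K L}

lemma one_le_degreeLEOne : 1 ≤ degreeLEOne M := le_sup_left

lemma ι_mem_degreeLEOne {x : L} (hx : x ∈ M) : ι K x ∈ degreeLEOne M :=
  Submodule.mem_sup_right ⟨x, hx, rfl⟩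

lemma degreeLT_le_succ (n : ℕ) : degreeLT M n ≤ degreeLT M (n + 1) := by
  cases n with
  | zero => exact bot_le
  | succ n =>
    rw [degreeLT, degreeLT]
    exact pow_le_pow_right' one_le_degreeLEOne n.le_succ

lemma degreeLT_mono (h : M ≤ M') (n : ℕ) : degreeLT M n ≤ degreeLT M' n := by
  cases n with
  | zero => exact le_rfl
  | succ n => exact pow_le_pow_left' (sup_le_sup le_rfl (Submodule.map_mono h)) n

lemma ι_mul_mem_degreeLT {x : L} (hx : x ∈ M) {n : ℕ} {u : 𝓤 K L} (hu : u ∈ degreeLT M n) :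
    ι K x * u ∈ degreeLT M (n + 1) := by
  cases n with
  | zero =>
    rw [degreeLT, Submodule.mem_bot] at hu
    simp [hu]
  | succ n =>
    rw [degreeLT, pow_succ']
    exact Submodule.mul_mem_mul (ι_mem_degreeLEOne hx) hu

lemma mem_degreeLT_one {u : 𝓤 K L} :
    u ∈ degreeLT M 1 ↔ ∃ c : K, algebraMap K (𝓤 K L) c = u := by
  rw [degreeLT, pow_zero, Submodule.mem_one]

/-- Induction along the filtration `degreeLT M`. -/
lemma degreeLT_induction {P : ℕ → 𝓤 K L → Prop}
    (algebraMap : ∀ c : K, P 0 (algebraMap K (𝓤 K L) c))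
    (add : ∀ n u v, P n u → P n v → P n (u + v))
    (succ : ∀ n u, u ∈ degreeLT M (n + 1) → P n u → P (n + 1) u)
    (ι_mul : ∀ n u x, x ∈ M → u ∈ degreeLT M (n + 1) → P n u → P (n + 1) (ι K x * u))
    (smul : ∀ n u (c : K), P n u → P n (c • u))
    {n : ℕ} {u : 𝓤 K L} (hu : u ∈ degreeLT M (n + 1)) : P n u := by
  induction n generalizing u with
  | zero =>
    obtain ⟨c, rfl⟩ := mem_degreeLT_one.1 hu
    exact algebraMap c
  | succ n ih =>
    rw [degreeLT, pow_succ'] at hu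
    induction hu using Submodule.mul_induction_on' with
    | mem_mul_mem a ha b hb =>
      obtain ⟨d, hd, _, ⟨x, hx, rfl⟩, rfl⟩ := Submodule.mem_sup.1 ha
      obtain ⟨c, rfl⟩ := Submodule.mem_one.1 hd
      rw [add_mul, ← Algebra.smul_def]
      exact add _ _ _ (smul _ _ _ (succ _ _ hb (ih hb))) (ι_mul _ _ _ hx hb (ih hb))
    | add a _ b _ ha hb => exact add _ _ _ ha hb

/-- Contraction of the first tensor factor with a linear form. -/
noncomputable def contractLeft : (𝓤 K L →ₗ[K] K) →ₗ[K] 𝓤 K L ⊗[K] 𝓤 K L →ₗ[K] 𝓤 K L :=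
  (LinearMap.llcomp K _ _ _ (TensorProduct.lid K (𝓤 K L)).toLinearMap) ∘ₗ
    LinearMap.rTensorHom (𝓤 K L)

lemma contractLeft_tmul (g : 𝓤 K L →ₗ[K] K) (u v : 𝓤 K L) :
    contractLeft g (u ⊗ₜ v) = g u • v := rfl

/-- The operator `(g ⊗ id) ∘ Δ` attached to a linear form `g`. -/
noncomputable def contractComul : (𝓤 K L →ₗ[K] K) →ₗ[K] 𝓤 K L →ₗ[K] 𝓤 K L :=
  (LinearMap.lcomp K _ (comulHom (K := K) (L := L)).toLinearMap) ∘ₗ contractLeft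

lemma contractComul_apply (g : 𝓤 K L →ₗ[K] K) (u : 𝓤 K L) :
    contractComul g u = contractLeft g (comulHom u) := rfl

lemma contractComul_algebraMap (g : 𝓤 K L →ₗ[K] K) (c : K) :
    contractComul g (algebraMap K (𝓤 K L) c) = algebraMap K (𝓤 K L) (c * g 1) := by
  rw [contractComul_apply, AlgHom.commutes, Algebra.TensorProduct.algebraMap_apply,
    contractLeft_tmul, Algebra.algebraMap_eq_smul_one, map_smul, Algebra.algebraMap_eq_smul_one,
    smul_eq_mul]

lemma contractComul_ι_mul (g : 𝓤 K L →ₗ[K] K) (x : L) (u : 𝓤 K L) :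
    contractComul g (ι K x * u) =
      ι K x * contractComul g u + contractComul (g ∘ₗ LinearMap.mulLeft K (ι K x)) u := by
  simp only [contractComul_apply, map_mul, comulHom_ι]
  induction comulHom u using TensorProduct.induction_on with
  | zero => simp
  | tmul a b => simp [add_mul, contractLeft_tmul, add_comm]
  | add a b ha hb => simp only [mul_add, map_add, ha, hb]; abel

lemma contractComul_mul_ι (g : 𝓤 K L →ₗ[K] K) (x : L) (u : 𝓤 K L) :
    contractComul g (u * ι K x) =
      contractComul g u * ι K x + contractComul (g ∘ₗ LinearMap.mulRight K (ι K x)) u := by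
  simp only [contractComul_apply, map_mul, comulHom_ι]
  induction comulHom u using TensorProduct.induction_on with
  | zero => simp
  | tmul a b => simp [mul_add, contractLeft_tmul, add_comm]
  | add a b ha hb => simp only [add_mul, map_add, ha, hb]; abel

lemma contractComul_counitHom (u : 𝓤 K L) :
    contractComul (counitHom (K := K) (L := L)).toLinearMap u = u := by
  let F : 𝓤 K L ⊗[K] 𝓤 K L →ₐ[K] 𝓤 K L :=
    Algebra.TensorProduct.lift ((Algebra.ofId K (𝓤 K L)).comp counitHom) (AlgHom.id K (𝓤 K L))
      fun a _ => Algebra.commutes (counitHom a) _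
  have hFt : ∀ a b, F (a ⊗ₜ b) = algebraMap K (𝓤 K L) (counitHom a) * b := fun a b =>
    Algebra.TensorProduct.lift_tmul ..
  have hF : ∀ t, contractLeft (counitHom (K := K) (L := L)).toLinearMap t = F t := fun t => by
    induction t using TensorProduct.induction_on with
    | zero => simp
    | tmul a b =>
      rw [contractLeft_tmul, Algebra.smul_def, hFt]
      rfl
    | add a b ha hb => simp only [map_add, ha, hb]
  have h : F.comp comulHom = AlgHom.id K (𝓤 K L) := by
    apply hom_ext
    ext x
    change F (comulHom (ι K x)) = ι K x
    rw [comulHom_ι, map_add, hFt, hFt, counitHom_ι, map_one, map_one, map_zero, zero_mul, one_mul,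
      zero_add]
  rw [contractComul_apply, hF]
  exact DFunLike.congr_fun h u

lemma contractComul_mem (g : 𝓤 K L →ₗ[K] K) {n : ℕ} {u : 𝓤 K L} (hu : u ∈ degreeLT M (n + 1)) :
    contractComul g u ∈ degreeLT M (n + 1) := by
  revert g
  refine degreeLT_induction (M := M)
    (P := fun n u => ∀ g, contractComul g u ∈ degreeLT M (n + 1)) ?_ ?_ ?_ ?_ ?_ hu
  · intro c g
    rw [contractComul_algebraMap]
    exact mem_degreeLT_one.2 ⟨_, rfl⟩
  · intro n u v hu hv g
    rw [map_add]
    exact add_mem (hu g) (hv g)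
  · intro n u _ h g
    exact degreeLT_le_succ _ (h g)
  · intro n u x hx _ h g
    rw [contractComul_ι_mul]
    exact add_mem (ι_mul_mem_degreeLT hx (h g)) (degreeLT_le_succ _ (h _))
  · intro n u c h g
    rw [map_smul]
    exact Submodule.smul_mem _ _ (h g)

lemma contractComul_mem_pred {g : 𝓤 K L →ₗ[K] K} (hg : g 1 = 0) {n : ℕ} {u : 𝓤 K L}
    (hu : u ∈ degreeLT M (n + 1)) : contractComul g u ∈ degreeLT M n := by
  refine degreeLT_induction (M := M)
    (P := fun n u => contractComul g u ∈ degreeLT M n) ?_ ?_ ?_ ?_ ?_ hu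
  · intro c
    rw [contractComul_algebraMap, hg, mul_zero, map_zero]
    exact zero_mem _
  · intro n u v hu hv
    rw [map_add]
    exact add_mem hu hv
  · intro n u _ h
    exact degreeLT_le_succ _ h
  · intro n u x hx hu h
    rw [contractComul_ι_mul]
    exact add_mem (ι_mul_mem_degreeLT hx h) (contractComul_mem _ hu)
  · intro n u c h
    rw [map_smul]
    exact Submodule.smul_mem _ _ h

lemma contractComul_mem_pred_pred {g : 𝓤 K L →ₗ[K] K} (hg : g 1 = 0)
    (hgM : ∀ x ∈ M, g (ι K x) = 0) {n : ℕ} {u : 𝓤 K L} (hu : u ∈ degreeLT M (n + 1)) :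
    contractComul g u ∈ degreeLT M (n - 1) := by
  refine degreeLT_induction (M := M)
    (P := fun n u => contractComul g u ∈ degreeLT M (n - 1)) ?_ ?_ ?_ ?_ ?_ hu
  · intro c
    rw [contractComul_algebraMap, hg, mul_zero, map_zero]
    exact zero_mem _
  · intro n u v hu hv
    rw [map_add]
    exact add_mem hu hv
  · intro n u hu _
    exact contractComul_mem_pred hg hu
  · intro n u x hx hu h
    rw [contractComul_ι_mul, Nat.add_sub_cancel]
    refine add_mem ?_ (contractComul_mem_pred (by
      rw [LinearMap.comp_apply, LinearMap.mulLeft_apply, mul_one, hgM x hx]) hu)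
    cases n with
    | zero =>
      have := contractComul_mem_pred hg hu
      rw [degreeLT, Submodule.mem_bot] at this
      simp [this]
    | succ n => exact ι_mul_mem_degreeLT hx h
  · intro n u c h
    rw [map_smul]
    exact Submodule.smul_mem _ _ h

lemma commutator_mem_degreeLT (w : L) {n : ℕ} {u : 𝓤 K L}
    (hu : u ∈ degreeLT (⊤ : Submodule K L) n) :
    ι K w * u - u * ι K w ∈ degreeLT (⊤ : Submodule K L) n := by
  cases n with
  | zero =>
    rw [degreeLT, Submodule.mem_bot] at hu
    simp [hu]
  | succ n =>
    refine degreeLT_induction (M := ⊤)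
      (P := fun n u => ι K w * u - u * ι K w ∈ degreeLT (⊤ : Submodule K L) (n + 1))
      ?_ ?_ ?_ ?_ ?_ hu
    · intro c
      rw [Algebra.commutes, sub_self]
      exact zero_mem _
    · intro n u v hu hv
      convert add_mem hu hv using 1
      noncomm_ring
    · intro n u _ h
      exact degreeLT_le_succ _ h
    · intro n u x _ hu h
      convert add_mem (ι_mul_mem_degreeLT (x := ⁅w, x⁆) Submodule.mem_top hu)
        (ι_mul_mem_degreeLT (x := x) Submodule.mem_top h) using 1
      rw [LieHom.map_lie, LieRing.of_associative_ring_bracket]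
      noncomm_ring
    · intro n u c h
      rw [mul_smul_comm, smul_mul_assoc, ← smul_sub]
      exact Submodule.smul_mem _ _ h

lemma contractComul_of_mem_center {z : 𝓤 K L} (hz : z ∈ Subalgebra.center K (𝓤 K L))
    (g : 𝓤 K L →ₗ[K] K) (w : L) :
    contractComul (g ∘ₗ (LinearMap.mulLeft K (ι K w) - LinearMap.mulRight K (ι K w))) z =
      -(ι K w * contractComul g z - contractComul g z * ι K w) := by
  have h := congrArg (contractComul g) (Subalgebra.mem_center_iff.1 hz (ι K w))
  rw [contractComul_ι_mul, contractComul_mul_ι] at h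
  rw [LinearMap.comp_sub, map_sub, LinearMap.sub_apply, eq_neg_iff_add_eq_zero]
  rw [← sub_eq_zero] at h
  rw [← h]
  abel

/-- Euler's formula for the associated graded algebra. -/
lemma sum_ι_mul_contractComul_sub_mem {J : Type*} [Fintype J] {b : J → L} {g : J → 𝓤 K L →ₗ[K] K}
    (hg : ∀ j, g j 1 = 0) (hgb : ∀ x ∈ M, ∑ j, g j (ι K x) • b j = x)
    {n : ℕ} {u : 𝓤 K L} (hu : u ∈ degreeLT M (n + 1)) :
    ∑ j, ι K (b j) * contractComul (g j) u - n • u ∈ degreeLT (⊤ : Submodule K L) n := by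
  refine degreeLT_induction (M := M)
    (P := fun n u => ∑ j, ι K (b j) * contractComul (g j) u - n • u ∈
      degreeLT (⊤ : Submodule K L) n) ?_ ?_ ?_ ?_ ?_ hu
  · intro c
    simp [contractComul_algebraMap, hg]
  · intro n u v hu hv
    convert add_mem hu hv using 1
    simp only [map_add, mul_add, Finset.sum_add_distrib, smul_add]
    abel
  · intro n u hu h
    convert sub_mem (degreeLT_le_succ _ h) (degreeLT_mono le_top _ hu) using 1
    rw [succ_nsmul]
    abel
  · intro n u x hx hu h
    have hu' := degreeLT_mono le_top _ hu
    set k : J → 𝓤 K L →ₗ[K] K := fun j => (g j) ∘ₗ LinearMap.mulLeft K (ι K x) -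
      g j (ι K x) • (counitHom (K := K) (L := L)).toLinearMap with hk
    have hk1 : ∀ j, k j 1 = 0 := fun j => by simp [hk]
    have key : ∀ j, ι K (b j) * contractComul (g j) (ι K x * u) =
        ι K ⁅b j, x⁆ * contractComul (g j) u + ι K x * (ι K (b j) * contractComul (g j) u) +
          ι K (b j) * contractComul (k j) u + ι K (g j (ι K x) • b j) * u := fun j => by
      rw [hk, map_sub, LinearMap.sub_apply, map_smul, LinearMap.smul_apply,
        contractComul_counitHom, contractComul_ι_mul, LieHom.map_lie,
        LieRing.of_associative_ring_bracket, map_smul, smul_mul_assoc, mul_sub, mul_smul_comm]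
      noncomm_ring
    have e : ∑ j, ι K (b j) * contractComul (g j) (ι K x * u) - (n + 1) • (ι K x * u) =
        ∑ j, (ι K ⁅b j, x⁆ * contractComul (g j) u + ι K (b j) * contractComul (k j) u) +
          ι K x * (∑ j, ι K (b j) * contractComul (g j) u - n • u) := by
      have hx' : ∑ j, ι K (g j (ι K x) • b j) * u = ι K x * u := by
        rw [← Finset.sum_mul, ← map_sum, hgb x hx]
      simp only [key, Finset.sum_add_distrib]
      rw [hx', mul_sub, ← Finset.mul_sum, succ_nsmul, mul_smul_comm]
      abel
    rw [e]
    refine add_mem (sum_mem fun j _ => add_mem ?_ ?_) (ι_mul_mem_degreeLT Submodule.mem_top h)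
    · exact ι_mul_mem_degreeLT Submodule.mem_top (contractComul_mem_pred (hg j) hu')
    · exact ι_mul_mem_degreeLT Submodule.mem_top (contractComul_mem_pred (hk1 j) hu')
  · intro n u c h
    convert Submodule.smul_mem _ c h using 1
    simp only [map_smul, mul_smul_comm, ← Finset.smul_sum, smul_sub]
    rw [smul_comm]

/-- An element all of whose first derivatives drop two steps in the filtration drops one step. -/
lemma mem_degreeLT_of_forall_contractComul_mem [CharZero K] [FiniteDimensional K M]
    (W : Submodule K (𝓤 K L →ₗ[K] K)) (hW1 : ∀ g ∈ W, g 1 = 0)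
    (hW : ∀ x ∈ M, (∀ g ∈ W, g (ι K x) = 0) → x = 0) {n : ℕ} {z : 𝓤 K L}
    (hz : z ∈ degreeLT M (n + 2))
    (hWz : ∀ g ∈ W, contractComul g z ∈ degreeLT (⊤ : Submodule K L) n) :
    z ∈ degreeLT (⊤ : Submodule K L) (n + 1) := by
  let r : (𝓤 K L →ₗ[K] K) →ₗ[K] Module.Dual K M :=
    LinearMap.lcomp K K ((ι K : L →ₗ⁅K⁆ 𝓤 K L).toLinearMap ∘ₗ M.subtype)
  have hr : W.map r = ⊤ := by
    have h0 : (W.map r).dualCoannihilator = ⊥ := by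
      rw [eq_bot_iff]
      intro x hx
      rw [Submodule.mem_dualCoannihilator] at hx
      exact (Submodule.mem_bot K).2
        (Subtype.ext (hW x x.2 fun g hg => hx (r g) (Submodule.mem_map_of_mem hg)))
    rw [← Subspace.dualCoannihilator_dualAnnihilator_eq (W := W.map r), h0]
    exact Submodule.dualAnnihilator_bot
  let B := Module.finBasis K M
  have hB : ∀ j, ∃ g ∈ W, r g = B.coord j := fun j => by
    have : B.coord j ∈ W.map r := hr ▸ Submodule.mem_top
    exact this
  choose g hgW hg using hB
  have h := sum_ι_mul_contractComul_sub_mem (b := fun j => (B j : L)) (fun j => hW1 _ (hgW j))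
    (fun x hx => by
      have h1 : ∀ j, g j (ι K x) = B.coord j ⟨x, hx⟩ := fun j => by
        rw [← hg j]
        rfl
      simp only [h1]
      have h2 := congrArg M.subtype (B.sum_repr ⟨x, hx⟩)
      rw [map_sum] at h2
      exact h2) hz
  have h2 : ∑ j, ι K (B j : L) * contractComul (g j) z ∈ degreeLT (⊤ : Submodule K L) (n + 1) :=
    sum_mem fun j _ => ι_mul_mem_degreeLT Submodule.mem_top (hWz _ (hgW j))
  have h3 := sub_mem h2 h
  rw [sub_sub_cancel, ← Nat.cast_smul_eq_nsmul K] at h3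
  exact (Submodule.smul_mem_iff _ (Nat.cast_ne_zero.2 n.succ_ne_zero)).1 h3

lemma exists_mem_degreeLT_top (z : 𝓤 K L) : ∃ n, z ∈ degreeLT (⊤ : Submodule K L) (n + 1) := by
  let S : Subalgebra K (𝓤 K L) :=
    { carrier := {z | ∃ n, z ∈ degreeLT (⊤ : Submodule K L) (n + 1)}
      mul_mem' := by
        rintro a b ⟨n, ha⟩ ⟨m, hb⟩
        refine ⟨n + m, ?_⟩
        rw [degreeLT, pow_add]
        exact Submodule.mul_mem_mul ha hb
      add_mem' := by
        rintro a b ⟨n, ha⟩ ⟨m, hb⟩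
        exact ⟨n + m, add_mem (pow_le_pow_right' one_le_degreeLEOne (Nat.le_add_right n m) ha)
          (pow_le_pow_right' one_le_degreeLEOne (Nat.le_add_left m n) hb)⟩
      algebraMap_mem' := fun c => ⟨0, mem_degreeLT_one.2 ⟨c, rfl⟩⟩ }
  have hS : ∀ x : L, ι K x ∈ S := fun x => ⟨1, by
    rw [degreeLT, pow_one]
    exact ι_mem_degreeLEOne Submodule.mem_top⟩
  let f : L →ₗ⁅K⁆ S :=
    { toLinearMap := (ι K : L →ₗ⁅K⁆ 𝓤 K L).toLinearMap.codRestrict S.toSubmodule hS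
      map_lie' := fun {x y} => Subtype.ext (LieHom.map_lie (ι K) x y) }
  have h : S.val.comp (lift K f) = AlgHom.id K (𝓤 K L) := by
    apply hom_ext
    ext x
    simp only [LieHom.comp_apply, AlgHom.coe_toLieHom, AlgHom.comp_apply, lift_ι_apply]
    rfl
  have h' : ((lift K f z : S) : 𝓤 K L) = z := DFunLike.congr_fun h z
  exact h' ▸ (lift K f z).2

lemma exists_mem_degreeLT_of_monotone {M : ℕ → Submodule K L} (hM : Monotone M)
    (hM' : ∀ x, ∃ N, x ∈ M N) {n : ℕ} {z : 𝓤 K L}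
    (hz : z ∈ degreeLT (⊤ : Submodule K L) (n + 1)) : ∃ N, z ∈ degreeLT (M N) (n + 1) := by
  refine degreeLT_induction (M := ⊤)
    (P := fun n z => ∃ N, z ∈ degreeLT (M N) (n + 1)) ?_ ?_ ?_ ?_ ?_ hz
  · exact fun c => ⟨0, mem_degreeLT_one.2 ⟨c, rfl⟩⟩
  · rintro n u v ⟨N, hu⟩ ⟨N', hv⟩
    exact ⟨max N N', add_mem (degreeLT_mono (hM (le_max_left _ _)) _ hu)
      (degreeLT_mono (hM (le_max_right _ _)) _ hv)⟩
  · rintro n u - ⟨N, hu⟩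
    exact ⟨N, degreeLT_le_succ _ hu⟩
  · rintro n u x - - ⟨N, hu⟩
    obtain ⟨N', hx⟩ := hM' x
    exact ⟨max N N', ι_mul_mem_degreeLT (hM (le_max_right _ _) hx)
      (degreeLT_mono (hM (le_max_left _ _)) _ hu)⟩
  · rintro n u c ⟨N, hu⟩
    exact ⟨N, Submodule.smul_mem _ _ hu⟩

end UniversalEnvelopingAlgebra

namespace LieAlgebra.Currents

open UniversalEnvelopingAlgebra
open Polynomial hiding degreeLT

attribute [local instance] LieRing.ofAssociativeRing

variable {𝔞 : Type*} [LieRing 𝔞] [LieAlgebra ℂ 𝔞]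

/-- The coefficient of `X ^ k` of a polynomial current. -/
noncomputable def coeff (k : ℕ) : ℂ[X] ⊗[ℂ] 𝔞 →ₗ[ℂ] 𝔞 :=
  (TensorProduct.lid ℂ 𝔞).toLinearMap ∘ₗ LinearMap.rTensor 𝔞 (lcoeff ℂ k)

lemma coeff_tmul (k : ℕ) (f : ℂ[X]) (x : 𝔞) : coeff k (f ⊗ₜ[ℂ] x) = f.coeff k • x := rfl

variable (𝔞) in
/-- The current `∑ k, X ^ k ⊗ a k` with coefficients `a`. -/
noncomputable def ofCoeffs (N : ℕ) : (Fin N → 𝔞) →ₗ[ℂ] ℂ[X] ⊗[ℂ] 𝔞 :=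
  ∑ k : Fin N, TensorProduct.mk ℂ ℂ[X] 𝔞 (X ^ (k : ℕ)) ∘ₗ LinearMap.proj k

lemma ofCoeffs_apply {N : ℕ} (a : Fin N → 𝔞) :
    ofCoeffs 𝔞 N a = ∑ k : Fin N, (X ^ (k : ℕ) : ℂ[X]) ⊗ₜ[ℂ] a k := by
  simp [ofCoeffs, LinearMap.sum_apply]

lemma X_pow_tmul_mem_range_ofCoeffs {k N : ℕ} (h : k < N) (x : 𝔞) :
    (X ^ k : ℂ[X]) ⊗ₜ[ℂ] x ∈ LinearMap.range (ofCoeffs 𝔞 N) := by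
  refine ⟨Pi.single ⟨k, h⟩ x, ?_⟩
  rw [ofCoeffs_apply, Finset.sum_eq_single ⟨k, h⟩]
  · simp
  · intro j _ hj
    rw [Pi.single_eq_of_ne hj, TensorProduct.tmul_zero]
  · simp

lemma monotone_range_ofCoeffs : Monotone fun N => LinearMap.range (ofCoeffs 𝔞 N) := by
  rintro N N' h _ ⟨a, rfl⟩
  rw [ofCoeffs_apply]
  exact sum_mem fun k _ => X_pow_tmul_mem_range_ofCoeffs (k.2.trans_le h) _

lemma exists_mem_range_ofCoeffs (u : ℂ[X] ⊗[ℂ] 𝔞) :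
    ∃ N, u ∈ LinearMap.range (ofCoeffs 𝔞 N) := by
  have hadd : ∀ u v : ℂ[X] ⊗[ℂ] 𝔞, (∃ N, u ∈ LinearMap.range (ofCoeffs 𝔞 N)) →
      (∃ N, v ∈ LinearMap.range (ofCoeffs 𝔞 N)) →
      ∃ N, u + v ∈ LinearMap.range (ofCoeffs 𝔞 N) := by
    rintro u v ⟨N, hu⟩ ⟨N', hv⟩
    exact ⟨max N N', add_mem (monotone_range_ofCoeffs (le_max_left _ _) hu)
      (monotone_range_ofCoeffs (le_max_right _ _) hv)⟩
  induction u using TensorProduct.induction_on with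
  | zero => exact ⟨0, zero_mem _⟩
  | tmul f x =>
    induction f using Polynomial.induction_on' with
    | add f g hf hg =>
      rw [TensorProduct.add_tmul]
      exact hadd _ _ hf hg
    | monomial n c =>
      refine ⟨n + 1, ?_⟩
      rw [← C_mul_X_pow_eq_monomial, ← smul_eq_C_mul, ← TensorProduct.smul_tmul']
      exact Submodule.smul_mem _ _ (X_pow_tmul_mem_range_ofCoeffs n.lt_succ_self x)
  | add u v hu hv => exact hadd _ _ hu hv

lemma eq_zero_of_forall_lie_lie_eq_zero (h : LieAlgebra.center ℂ 𝔞 = ⊥) {x : 𝔞}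
    (hx : ∀ y y' : 𝔞, ⁅⁅y, x⁆, y'⁆ = 0) : x = 0 := by
  have hc : ∀ x : 𝔞, (∀ y, ⁅y, x⁆ = 0) → x = 0 := fun x hx => by
    have : x ∈ LieAlgebra.center ℂ 𝔞 := (LieModule.mem_maxTrivSubmodule ℂ 𝔞 𝔞 x).2 hx
    rwa [h, LieSubmodule.mem_bot] at this
  refine hc x fun y => hc _ fun y' => ?_
  rw [← lie_skew, hx, neg_zero]

/-- The matrix coefficient `u ↦ ψ (coeff k (u · (1 ⊗ y)))` of the adjoint representation. -/
noncomputable def matrixCoeff (k : ℕ) (ψ : Module.Dual ℂ 𝔞) (y : 𝔞) :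
    UniversalEnvelopingAlgebra ℂ (ℂ[X] ⊗[ℂ] 𝔞) →ₗ[ℂ] ℂ :=
  ψ ∘ₗ coeff k ∘ₗ LinearMap.applyₗ ((1 : ℂ[X]) ⊗ₜ[ℂ] y) ∘ₗ
    (lift ℂ (LieAlgebra.ad ℂ (ℂ[X] ⊗[ℂ] 𝔞))).toLinearMap

lemma matrixCoeff_one {k : ℕ} (hk : k ≠ 0) (ψ : Module.Dual ℂ 𝔞) (y : 𝔞) :
    matrixCoeff k ψ y 1 = 0 := by
  change ψ (coeff k (lift ℂ (LieAlgebra.ad ℂ (ℂ[X] ⊗[ℂ] 𝔞)) 1 ((1 : ℂ[X]) ⊗ₜ[ℂ] y))) = 0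
  rw [map_one, Module.End.one_apply, coeff_tmul, coeff_one, if_neg hk, zero_smul, map_zero]

lemma matrixCoeff_ι (k l : ℕ) (ψ : Module.Dual ℂ 𝔞) (x y : 𝔞) :
    matrixCoeff k ψ y (ι ℂ ((X ^ l : ℂ[X]) ⊗ₜ[ℂ] x)) = if k = l then ψ ⁅x, y⁆ else 0 := by
  change ψ (coeff k (lift ℂ (LieAlgebra.ad ℂ (ℂ[X] ⊗[ℂ] 𝔞)) (ι ℂ ((X ^ l : ℂ[X]) ⊗ₜ[ℂ] x))
    ((1 : ℂ[X]) ⊗ₜ[ℂ] y))) = _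
  rw [lift_ι_apply, LieAlgebra.ad_apply, ExtendScalars.bracket_tmul, mul_one, coeff_tmul,
    coeff_X_pow]
  split_ifs <;> simp

lemma mem_degreeLT_of_mem_center (h : LieAlgebra.center ℂ 𝔞 = ⊥) [FiniteDimensional ℂ 𝔞]
    {z : UniversalEnvelopingAlgebra ℂ (ℂ[X] ⊗[ℂ] 𝔞)}
    (hz : z ∈ Subalgebra.center ℂ (UniversalEnvelopingAlgebra ℂ (ℂ[X] ⊗[ℂ] 𝔞))) {n : ℕ}
    (hzn : z ∈ degreeLT (⊤ : Submodule ℂ (ℂ[X] ⊗[ℂ] 𝔞)) (n + 2)) :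
    z ∈ degreeLT (⊤ : Submodule ℂ (ℂ[X] ⊗[ℂ] 𝔞)) (n + 1) := by
  obtain ⟨N, hzN⟩ := exists_mem_degreeLT_of_monotone monotone_range_ofCoeffs
    exists_mem_range_ofCoeffs hzn
  let W : Submodule ℂ (UniversalEnvelopingAlgebra ℂ (ℂ[X] ⊗[ℂ] 𝔞) →ₗ[ℂ] ℂ) :=
    LinearMap.ker (LinearMap.applyₗ (R := ℂ) (M₂ := ℂ)
      (1 : UniversalEnvelopingAlgebra ℂ (ℂ[X] ⊗[ℂ] 𝔞))) ⊓
    (degreeLT (⊤ : Submodule ℂ (ℂ[X] ⊗[ℂ] 𝔞)) n).comap (contractComul.flip z)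
  refine mem_degreeLT_of_forall_contractComul_mem W (fun g hg => hg.1) ?_ hzN fun g hg => hg.2
  rintro _ ⟨a, rfl⟩ ha
  suffices a = 0 by rw [this, map_zero]
  funext k
  refine eq_zero_of_forall_lie_lie_eq_zero h fun y y' => ?_
  rw [← Module.forall_dual_apply_eq_zero_iff ℂ]
  intro ψ
  set w := (X ^ (N + 1) : ℂ[X]) ⊗ₜ[ℂ] y with hw
  set f := matrixCoeff (N + 1 + k) ψ y' with hf
  have hf1 : f 1 = 0 := matrixCoeff_one (by omega) ψ y'
  have hfM : ∀ x ∈ LinearMap.range (ofCoeffs 𝔞 N), f (ι ℂ x) = 0 := by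
    rintro _ ⟨b, rfl⟩
    rw [ofCoeffs_apply, map_sum, map_sum]
    refine Finset.sum_eq_zero fun l _ => ?_
    rw [hf, matrixCoeff_ι, if_neg (by omega)]
  have hg : f ∘ₗ (LinearMap.mulLeft ℂ (ι ℂ w) - LinearMap.mulRight ℂ (ι ℂ w)) ∈ W := by
    refine ⟨?_, ?_⟩
    · change f (ι ℂ w * 1 - 1 * ι ℂ w) = 0
      rw [mul_one, one_mul, sub_self, map_zero]
    · change contractComul _ z ∈ degreeLT _ n
      rw [contractComul_of_mem_center hz]
      exact neg_mem (commutator_mem_degreeLT w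
        (degreeLT_mono le_top _ (contractComul_mem_pred_pred hf1 hfM hzN)))
  have h0 := ha _ hg
  rw [LinearMap.comp_apply, LinearMap.sub_apply, LinearMap.mulLeft_apply,
    LinearMap.mulRight_apply, ← LieRing.of_associative_ring_bracket, ← LieHom.map_lie,
    ofCoeffs_apply, lie_sum, map_sum, map_sum, Finset.sum_eq_single k] at h0
  · rwa [hw, ExtendScalars.bracket_tmul, ← pow_add, hf, matrixCoeff_ι, if_pos rfl] at h0
  · intro l _ hl
    rw [hw, ExtendScalars.bracket_tmul, ← pow_add, hf, matrixCoeff_ι, if_neg]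
    intro hkl
    exact hl (Fin.ext (by omega))
  · simp

end LieAlgebra.Currents

/-- if `𝔞` is a finite-dimensional complex Lie algebra whose centre is zero,
then the centre of the universal enveloping algebra `U(𝔞[X])` of the polynomial current Lie
algebra `𝔞[X] = ℂ[X] ⊗ 𝔞` is trivial, i.e. equals `ℂ·1`. -/
theorem center_of_enveloping_of_currents (𝔞 : Type) [LieRing 𝔞] [LieAlgebra ℂ 𝔞]
    [FiniteDimensional ℂ 𝔞] (h : LieAlgebra.center ℂ 𝔞 = ⊥) :
    Subalgebra.center ℂ (UniversalEnvelopingAlgebra ℂ (Polynomial ℂ ⊗[ℂ] 𝔞)) = ⊥ := by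
  refine eq_bot_iff.2 fun z hz => ?_
  have key : ∀ n : ℕ, z ∈ UniversalEnvelopingAlgebra.degreeLT
      (⊤ : Submodule ℂ (Polynomial ℂ ⊗[ℂ] 𝔞)) (n + 1) → ∃ c : ℂ, algebraMap ℂ _ c = z := by
    intro n
    induction n with
    | zero => exact UniversalEnvelopingAlgebra.mem_degreeLT_one.1
    | succ n ih => exact fun hn => ih (LieAlgebra.Currents.mem_degreeLT_of_mem_center h hz hn)
  obtain ⟨n, hn⟩ := UniversalEnvelopingAlgebra.exists_mem_degreeLT_top z
  exact Algebra.mem_bot.2 (key n hn)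
end
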